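/- Let K ≥ 1, β > 0, p0 : Fin (K+1) → ℝ a strictly positive probability vector, rewards r : Fin (K+1) → ℝ, and J(θ) = ∑_i r_i · softmax(θ)_i − β ∑_i softmax(θ)_i · log(softmax(θ)_i / p0_i). If all partial derivatives of J vanish at θ* and p*_i = softmax(θ*)_i, then there exists a constant c ∈ ℝ such that for every k ∈ Fin (K+1): r_k − β · log(p*_k / p0_k) = c. -/

import Mathlib

/-- The softmax distribution associated to a parameter vector `θ`. -/
noncomputable def softmax {n : ℕ} (θ : Fin n → ℝ) (i : Fin n) : ℝ :=
  Real.exp (θ i) / ∑ j, Real.exp (θ j)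

theorem softmax_pos {n : ℕ} [NeZero n] (θ : Fin n → ℝ) (i : Fin n) : 0 < softmax θ i :=
  div_pos (Real.exp_pos _) (Finset.sum_pos (fun _ _ => Real.exp_pos _) Finset.univ_nonempty)

/-- The partial derivatives of the softmax map. -/
theorem hasDerivAt_softmax_update {n : ℕ} [NeZero n] (θ : Fin n → ℝ) (k i : Fin n) :
    HasDerivAt (fun s : ℝ => softmax (Function.update θ k s) i)
      (softmax θ i * ((Pi.single k 1 : Fin n → ℝ) i - softmax θ k)) (θ k) := by
  have hexp (j : Fin n) : HasDerivAt (fun s : ℝ => Real.exp (Function.update θ k s j))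
      (Real.exp (θ j) * (Pi.single k 1 : Fin n → ℝ) j) (θ k) := by
    simpa using ((hasDerivAt_pi.1 (hasDerivAt_update θ k (θ k))) j).exp
  have hpos : 0 < ∑ j, Real.exp (θ j) :=
    Finset.sum_pos (fun _ _ => Real.exp_pos _) Finset.univ_nonempty
  have hsum : HasDerivAt (fun s : ℝ => ∑ j, Real.exp (Function.update θ k s j))
      (Real.exp (θ k)) (θ k) := by
    refine (HasDerivAt.fun_sum fun j _ => hexp j).congr_deriv ?_
    simp [Pi.single_apply]
  refine ((hexp i).fun_div hsum (by simpa using hpos.ne')).congr_deriv ?_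
  simp only [Function.update_eq_self, softmax]
  field_simp

/-- The partial derivatives of the relative-entropy-regularized expected reward of a softmax
policy. -/
theorem hasDerivAt_regularized_reward_update {n : ℕ} [NeZero n] (β : ℝ) (q r : Fin n → ℝ)
    (hq : ∀ i, 0 < q i) (θ : Fin n → ℝ) (k : Fin n) :
    HasDerivAt (fun s : ℝ => ∑ i, r i * softmax (Function.update θ k s) i -
        β * ∑ i, softmax (Function.update θ k s) i *
          Real.log (softmax (Function.update θ k s) i / q i))
      (softmax θ k * ((r k - β * Real.log (softmax θ k / q k) - β) -
        ∑ i, softmax θ i * (r i - β * Real.log (softmax θ i / q i) - β))) (θ k) := by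
  have hentropy (i : Fin n) : HasDerivAt
      (fun s : ℝ => softmax (Function.update θ k s) i *
        Real.log (softmax (Function.update θ k s) i / q i))
      (softmax θ i * ((Pi.single k 1 : Fin n → ℝ) i - softmax θ k) *
        (Real.log (softmax θ i / q i) + 1)) (θ k) := by
    have hp := hasDerivAt_softmax_update θ k i
    have hpos := softmax_pos θ i
    refine (hp.fun_mul ((hp.div_const (q i)).log
      (by simpa using (div_pos hpos (hq i)).ne'))).congr_deriv ?_
    have := hq i
    simp only [Function.update_eq_self]
    field_simp
  refine ((HasDerivAt.fun_sum fun i _ =>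
    (hasDerivAt_softmax_update θ k i).const_mul (r i)).fun_sub
    ((HasDerivAt.fun_sum fun i _ => hentropy i).const_mul β)).congr_deriv ?_
  symm
  rw [Finset.mul_sum, ← Finset.sum_sub_distrib, mul_sub, Finset.mul_sum]
  have hsingle : softmax θ k * (r k - β * Real.log (softmax θ k / q k) - β) =
      ∑ i, (Pi.single k 1 : Fin n → ℝ) i *
        (softmax θ i * (r i - β * Real.log (softmax θ i / q i) - β)) := by
    simp [Pi.single_apply]
  rw [hsingle, ← Finset.sum_sub_distrib]
  exact Finset.sum_congr rfl fun i _ => by ring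

/-- **First-order optimality condition for KL-regularized REINFORCE.**
For the objective `J(θ) = ∑ i, r i · softmax θ i − β ∑ i, softmax θ i · log (softmax θ i / p0 i)`,
if all partial derivatives of `J` vanish at `θ*` and `p* = softmax θ*`, then there exists a
constant `c` such that `r k − β · log (p*_k / p0_k) = c` for every arm `k`. -/
theorem KL_regularized_first_order_condition
    (K : ℕ) (hK : 1 ≤ K) (β : ℝ) (hβ : 0 < β)
    (p0 : Fin (K + 1) → ℝ) (hp0pos : ∀ i, 0 < p0 i) (hp0sum : ∑ i, p0 i = 1)
    (r : Fin (K + 1) → ℝ)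
    (J : (Fin (K + 1) → ℝ) → ℝ)
    (hJ : ∀ θ, J θ = ∑ i, r i * softmax θ i -
      β * ∑ i, softmax θ i * Real.log (softmax θ i / p0 i))
    (θs : Fin (K + 1) → ℝ)
    (hcrit : ∀ k, HasDerivAt (fun s : ℝ => J (Function.update θs k s)) 0 (θs k)) :
    ∃ c : ℝ, ∀ k : Fin (K + 1),
      r k - β * Real.log (softmax θs k / p0 k) = c := by
  refine ⟨β + ∑ i, softmax θs i * (r i - β * Real.log (softmax θs i / p0 i) - β), fun k => ?_⟩
  have hk := hcrit k
  simp only [hJ] at hk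
  have hzero := (hasDerivAt_regularized_reward_update β p0 r hp0pos θs k).unique hk
  have hfactor := (mul_eq_zero.1 hzero).resolve_left (softmax_pos θs k).ne'
  linarith
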